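/- (Bates) Let n ≥ m be positive integers and f: ℝⁿ → ℝᵐ of class C^{n-m,1} (i.e., f is (n-m) times differentiable with Lipschitz (n-m)-th derivative; for n = m this means f is of class C^{0,1}). Then the set of critical values f(C_f), where C_f = {x : rank Df(x) < m}, has Lebesgue measure zero in ℝᵐ. -/

import Mathlib

open MeasureTheory Metric Filter Set

noncomputable section

/-- `ℝⁿ` as a Euclidean space. -/
abbrev Ec (n : ℕ) := EuclideanSpace ℝ (Fin n)

/-- The set `A` has vanishing Lebesgue density at `x`. -/
def apSmall {n : ℕ} (x : Ec n) (A : Set (Ec n)) : Prop :=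
  Tendsto (fun r : ℝ => volume (A ∩ ball x r) / volume (ball x r))
    (nhdsWithin 0 (Ioi 0)) (nhds 0)

/-- `f` is approximately differentiable of order `k` at `x`, with Taylor polynomial
`y ↦ ∑_{j ≤ k} (p j) (y-x)^j = p.partialSum (k+1) (y-x)` (here the coefficient maps `p j`
already incorporate the factor `1/j!`): the approximate limit of
`|f y - p_k(x;y)|/|y-x|^k` as `y → x` is `0`. -/
def IsApproxTaylor {n m : ℕ} (f : Ec n → Ec m) (k : ℕ) (x : Ec n)
    (p : FormalMultilinearSeries ℝ (Ec n) (Ec m)) : Prop :=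
  ∀ ε > (0 : ℝ),
    apSmall x {y | y ≠ x ∧ ε * ‖y - x‖ ^ k ≤ ‖f y - p.partialSum (k + 1) (y - x)‖}
/-- The rank of the derivative of `f` at `x`. -/
def derivRank {n m : ℕ} (f : Ec n → Ec m) (x : Ec n) : ℕ :=
  Module.finrank ℝ (LinearMap.range ((fderiv ℝ f x : Ec n →L[ℝ] Ec m) : Ec n →ₗ[ℝ] Ec m))

section Auxiliary

open scoped Topology unitInterval NNReal ENNReal

section Regularity

variable {E F : Type*} [NormedAddCommGroup E] [NormedSpace ℝ E]
  [NormedAddCommGroup F] [NormedSpace ℝ F] {k : ℕ} {α : I}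

theorem ContDiffPointwiseHolderAt.of_fderiv {f : E → F} {a : E}
    (hf : ContDiffAt ℝ (k + 1 : ℕ) f a) (hf' : ContDiffPointwiseHolderAt k α (fderiv ℝ f) a) :
    ContDiffPointwiseHolderAt (k + 1) α f a where
  contDiffAt := hf
  isBigO := .of_norm_left <| by
    simpa [iteratedFDeriv_succ_eq_comp_right, Function.comp_def, ← dist_eq_norm_sub]
      using hf'.isBigO.norm_left

theorem OpenPartialHomeomorph.fderiv_symm_eq_inverse (Φ : OpenPartialHomeomorph E F) {a : F}
    (ha : a ∈ Φ.target) (h : DifferentiableAt ℝ Φ (Φ.symm a))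
    (h' : DifferentiableAt ℝ Φ.symm a) :
    fderiv ℝ Φ.symm a = (fderiv ℝ Φ (Φ.symm a)).inverse := by
  symm
  apply ContinuousLinearMap.inverse_eq
  · have h1 : HasFDerivAt (Φ ∘ Φ.symm) ((fderiv ℝ Φ (Φ.symm a)).comp (fderiv ℝ Φ.symm a)) a :=
      h.hasFDerivAt.comp a h'.hasFDerivAt
    have h2 : HasFDerivAt (Φ ∘ Φ.symm) (ContinuousLinearMap.id ℝ F) a :=
      (hasFDerivAt_id a).congr_of_eventuallyEq (Φ.eventually_right_inverse ha)
    exact h1.unique h2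
  · have ha' := Φ.map_target ha
    have hh : HasFDerivAt Φ.symm (fderiv ℝ Φ.symm a) (Φ (Φ.symm a)) := by
      rw [Φ.right_inv ha]; exact h'.hasFDerivAt
    have h1 : HasFDerivAt (Φ.symm ∘ Φ)
        ((fderiv ℝ Φ.symm a).comp (fderiv ℝ Φ (Φ.symm a))) (Φ.symm a) :=
      hh.comp _ h.hasFDerivAt
    have h2 : HasFDerivAt (Φ.symm ∘ Φ) (ContinuousLinearMap.id ℝ E) (Φ.symm a) :=
      (hasFDerivAt_id _).congr_of_eventuallyEq (Φ.eventually_left_inverse ha')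
    exact h1.unique h2

/-- The inverse of a local diffeomorphism is as regular, in the sense of
`ContDiffPointwiseHolderAt`, as the diffeomorphism itself. -/
theorem OpenPartialHomeomorph.contDiffPointwiseHolderAt_symm [CompleteSpace E]
    (Φ : OpenPartialHomeomorph E F) {e : E ≃L[ℝ] F} {a : F} (ha : a ∈ Φ.target)
    (he : HasFDerivAt Φ (e : E →L[ℝ] F) (Φ.symm a)) (hk : k ≠ 0)
    (hΦ : ContDiffPointwiseHolderAt k α Φ (Φ.symm a)) :
    ContDiffPointwiseHolderAt k α Φ.symm a := by
  have hs : ContDiffAt ℝ k Φ.symm a := Φ.contDiffAt_symm ha he hΦ.contDiffAt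
  suffices H : ∀ l ≤ k, ContDiffPointwiseHolderAt l α Φ.symm a from H k le_rfl
  intro l
  induction l with
  | zero =>
    intro _
    exact hs.contDiffPointwiseHolderAt (mod_cast Nat.pos_of_ne_zero hk) α
  | succ l ih =>
    intro hl
    refine .of_fderiv (hs.of_le (mod_cast hl)) ?_
    have hinv : ContDiffPointwiseHolderAt l α
        (ContinuousLinearMap.inverse : (E →L[ℝ] F) → F →L[ℝ] E) (fderiv ℝ Φ (Φ.symm a)) := by
      rw [he.fderiv]
      exact (contDiffAt_map_inverse (n := (l + 1 : ℕ)) e).contDiffPointwiseHolderAt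
        (mod_cast Nat.lt_succ_self l) α
    have hinv' : DifferentiableAt ℝ
        (ContinuousLinearMap.inverse : (E →L[ℝ] F) → F →L[ℝ] E) (fderiv ℝ Φ (Φ.symm a)) := by
      rw [he.fderiv]
      exact (contDiffAt_map_inverse (n := 1) e).differentiableAt one_ne_zero
    have hd : ContDiffPointwiseHolderAt l α (fderiv ℝ Φ ∘ Φ.symm) a :=
      (hΦ.fderiv hl).comp_of_differentiableAt a (ih (Nat.le_of_succ_le hl))
        (.inr (hs.differentiableAt (mod_cast hk)))
    have := hinv.comp_of_differentiableAt (f := fderiv ℝ Φ ∘ Φ.symm) a hd (.inl hinv')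
    refine this.congr_of_eventuallyEq ?_
    have k1 : (1 : WithTop ℕ∞) ≤ k := mod_cast Nat.one_le_iff_ne_zero.2 hk
    have e1 : ∀ᶠ y in 𝓝 a, DifferentiableAt ℝ Φ.symm y :=
      ((hs.of_le k1).eventually (by simp)).mono fun y hy => hy.differentiableAt one_ne_zero
    have e2 : ∀ᶠ y in 𝓝 a, DifferentiableAt ℝ Φ (Φ.symm y) :=
      (Φ.continuousAt_symm ha).eventually <|
        ((hΦ.contDiffAt.of_le k1).eventually (by simp)).mono
          fun y hy => hy.differentiableAt one_ne_zero
    filter_upwards [e1, e2, Φ.open_target.mem_nhds ha] with y h1 h2 h3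
    exact (Φ.fderiv_symm_eq_inverse h3 h2 h1).symm

/-- A `C¹` function with nonzero derivative becomes the first coordinate in suitable
coordinates on `ℝ × E'`. -/
theorem exists_straightening [FiniteDimensional ℝ E] {h : E → ℝ} {x₀ : E}
    (hh : ContDiffAt ℝ 1 h x₀) (hne : fderiv ℝ h x₀ ≠ 0) :
    ∃ (E' : Submodule ℝ E) (π : E →L[ℝ] E') (Φ : OpenPartialHomeomorph E (ℝ × E')) (C : ℝ),
      Module.finrank ℝ E' + 1 = Module.finrank ℝ E ∧ x₀ ∈ Φ.source ∧ (∀ x, Φ x = (h x, π x)) ∧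
      (∀ p ∈ Φ.target, ContDiffAt ℝ 1 Φ.symm p ∧ ‖fderiv ℝ Φ.symm p‖ ≤ C) ∧
      ∀ p ∈ Φ.target, ∀ k ≠ 0, ∀ α, ContDiffPointwiseHolderAt k α h (Φ.symm p) →
        ContDiffPointwiseHolderAt k α Φ.symm p := by
  set T := fderiv ℝ h x₀ with hT
  obtain ⟨e, he⟩ : ∃ e, T e ≠ 0 := by
    by_contra! H
    exact hne (ContinuousLinearMap.ext H)
  let R : ℝ →L[ℝ] E := ContinuousLinearMap.toSpanSingleton ℝ ((T e)⁻¹ • e)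
  have hR : Function.RightInverse R T := fun t => by simp [R, he]
  let A := ContinuousLinearEquiv.equivOfRightInverse T R hR
  let π : E →L[ℝ] T.ker := T.projKerOfRightInverse R hR
  let G : E → ℝ × T.ker := fun x => (h x, π x)
  have hG : ∀ x, ContDiffAt ℝ 1 h x → ContDiffAt ℝ 1 G x := fun x hx =>
    hx.prodMk π.contDiff.contDiffAt
  have hA : HasFDerivAt G (A : E →L[ℝ] ℝ × T.ker) x₀ :=
    (hh.differentiableAt one_ne_zero).hasFDerivAt.prodMk π.hasFDerivAt
  let Ψ := (hG x₀ hh).toOpenPartialHomeomorph G hA one_ne_zero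
  have hx₀ : x₀ ∈ Ψ.source := ContDiffAt.mem_toOpenPartialHomeomorph_source _ _ _
  have hΨ : (Ψ : E → ℝ × T.ker) = G := rfl
  have hsymm : ContDiffAt ℝ 1 Ψ.symm (Ψ x₀) := by
    refine Ψ.contDiffAt_symm (Ψ.map_source hx₀) (f₀' := A) ?_ ?_ <;>
      rw [Ψ.left_inv hx₀, hΨ]
    · exact hA
    · exact hG x₀ hh
  have c1 : ∀ᶠ x in 𝓝 x₀, ContDiffAt ℝ 1 h x := hh.eventually (by simp)
  have c2 : ∀ᶠ x in 𝓝 x₀, fderiv ℝ G x ∈ range ((↑) : (E ≃L[ℝ] ℝ × T.ker) → E →L[ℝ] ℝ × T.ker) := by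
    have := ((hG x₀ hh).continuousAt_fderiv one_ne_zero)
    refine this (ContinuousLinearEquiv.isOpen.mem_nhds ⟨A, hA.fderiv.symm⟩)
  have c3 : ∀ᶠ x in 𝓝 x₀, ‖fderiv ℝ Ψ.symm (Ψ x)‖ < ‖fderiv ℝ Ψ.symm (Ψ x₀)‖ + 1 := by
    have := (hsymm.continuousAt_fderiv one_ne_zero).norm.comp (Ψ.continuousAt hx₀)
    exact this.eventually_lt continuousAt_const (by simp)
  obtain ⟨V, hV, Vo, xV⟩ := _root_.eventually_nhds_iff.1 (c1.and (c2.and c3))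
  have key : ∀ p ∈ (Ψ.restrOpen V Vo).target, p ∈ Ψ.target ∧ Ψ.symm p ∈ V := by
    intro p hp
    have := (Ψ.restrOpen V Vo).map_target hp
    rw [Ψ.restrOpen_source] at this
    exact ⟨hp.1, this.2⟩
  have hs : ((Ψ.restrOpen V Vo).symm : ℝ × T.ker → E) = Ψ.symm := rfl
  refine ⟨T.ker, π, Ψ.restrOpen V Vo, ‖fderiv ℝ Ψ.symm (Ψ x₀)‖ + 1, ?_, ?_, fun x => rfl, ?_, ?_⟩
  · have := A.toLinearEquiv.finrank_eq
    rw [this, Module.finrank_prod, Module.finrank_self, add_comm]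
  · rw [Ψ.restrOpen_source]; exact ⟨hx₀, xV⟩
  · intro p hp
    obtain ⟨h1, h2⟩ := key p hp
    obtain ⟨d1, ⟨B, hB⟩, d3⟩ := hV _ h2
    rw [Ψ.right_inv h1] at d3
    rw [hs]
    refine ⟨Ψ.contDiffAt_symm h1 (f₀' := B) ?_ (hG _ d1), d3.le⟩
    rw [hB]
    exact ((hG _ d1).differentiableAt one_ne_zero).hasFDerivAt
  · intro p hp k hk α hreg
    obtain ⟨h1, h2⟩ := key p hp
    obtain ⟨d1, ⟨B, hB⟩, d3⟩ := hV _ h2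
    rw [hs] at hreg ⊢
    refine Ψ.contDiffPointwiseHolderAt_symm h1 (e := B) ?_ hk ?_
    · rw [hB]
      exact ((hG _ d1).differentiableAt one_ne_zero).hasFDerivAt
    · exact hreg.prodMk π.contDiffPointwiseHolderAt

end Regularity

section Decomposition

/-- `A` is covered by countably many sets satisfying `P`. -/
def CountablyCovered {X : Type*} (P : Set X → Prop) (A : Set X) : Prop :=
  ∃ T : Set (Set X), T.Countable ∧ A ⊆ ⋃₀ T ∧ ∀ S ∈ T, P S

namespace CountablyCovered

variable {X : Type*} {P Q : Set X → Prop} {A B : Set X}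

theorem mono_set (h : CountablyCovered P A) (hB : B ⊆ A) : CountablyCovered P B :=
  let ⟨T, hT, hA, hP⟩ := h
  ⟨T, hT, hB.trans hA, hP⟩

theorem mono (h : CountablyCovered P A) (hPQ : ∀ S, P S → Q S) : CountablyCovered Q A :=
  let ⟨T, hT, hA, hP⟩ := h
  ⟨T, hT, hA, fun S hS => hPQ S (hP S hS)⟩

theorem biUnion {ι : Type*} {s : Set ι} (hs : s.Countable) {A : ι → Set X}
    (h : ∀ i ∈ s, CountablyCovered P (A i)) : CountablyCovered P (⋃ i ∈ s, A i) := by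
  choose! T hT hA hP using h
  refine ⟨⋃ i ∈ s, T i, hs.biUnion hT, ?_, ?_⟩
  · refine iUnion₂_subset fun i hi => (hA i hi).trans ?_
    exact sUnion_subset_sUnion (subset_biUnion_of_mem hi)
  · intro S hS
    obtain ⟨i, hi, hS⟩ := mem_iUnion₂.1 hS
    exact hP i hi S hS

theorem iUnion {A : ℕ → Set X}
    (h : ∀ i, CountablyCovered P (A i)) : CountablyCovered P (⋃ i, A i) := by
  simpa using biUnion (s := univ) countable_univ (A := A) fun i _ => h i

theorem union (hA : CountablyCovered P A) (hB : CountablyCovered P B) :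
    CountablyCovered P (A ∪ B) := by
  obtain ⟨T, hT, hA, hP⟩ := hA
  obtain ⟨T', hT', hB, hP'⟩ := hB
  refine ⟨T ∪ T', hT.union hT', ?_, ?_⟩
  · rw [sUnion_union]; exact union_subset_union hA hB
  · rintro S (h | h)
    exacts [hP S h, hP' S h]

theorem of_mem (h : P A) : CountablyCovered P A :=
  ⟨{A}, countable_singleton A, by simp, by simpa⟩

theorem of_locally [TopologicalSpace X] [SecondCountableTopology X]
    (h : ∀ x ∈ A, ∃ V ∈ 𝓝 x, CountablyCovered P (A ∩ V)) : CountablyCovered P A := by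
  choose! V hV hP using h
  obtain ⟨t, htA, htc, ht⟩ := TopologicalSpace.countable_cover_nhdsWithin (s := A) (f := V)
    fun x hx => mem_nhdsWithin_of_mem_nhds (hV x hx)
  refine (biUnion htc (A := fun x => A ∩ V x) fun x hx => hP x (htA hx)).mono_set ?_
  intro x hx
  obtain ⟨i, hi, hx'⟩ := mem_iUnion₂.1 (ht hx)
  exact mem_iUnion₂.2 ⟨i, hi, hx, hx'⟩

end CountablyCovered

variable {E F : Type} [NormedAddCommGroup E] [NormedSpace ℝ E]
  [NormedAddCommGroup F] [NormedSpace ℝ F]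

/-- The points `x` and `y` are joined by a curve in `U` of speed at most `C * ‖x - y‖`, along
which `φ` is bounded by `C * ‖x - y‖ ^ j`. -/
def CurveJoined (U : Set E) (φ : E → F) (j : ℕ) (C : ℝ) (x y : E) : Prop :=
  ∃ γ γ' : ℝ → E, γ 0 = x ∧ γ 1 = y ∧ ∀ t ∈ Icc (0 : ℝ) 1,
    HasDerivWithinAt γ (γ' t) (Icc 0 1) t ∧ ‖γ' t‖ ≤ C * ‖x - y‖ ∧ γ t ∈ U ∧
      ‖φ (γ t)‖ ≤ C * ‖x - y‖ ^ j

/-- Any two points of `S` are joined by a curve as in `CurveJoined`, with a uniform constant. -/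
def UniformlyCurveJoined (U : Set E) (φ : E → F) (j : ℕ) (S : Set E) : Prop :=
  ∃ C, 0 ≤ C ∧ ∀ x ∈ S, ∀ y ∈ S, CurveJoined U φ j C x y

/-- If the derivative of `g` is small along a curve, then so is the variation of `g`. -/
theorem CurveJoined.norm_sub_le {U : Set E} {g : E → F} {j : ℕ} {C : ℝ} (hC : 0 ≤ C) {x y : E}
    {γ γ' : ℝ → E} (h0 : γ 0 = x)
    (hγ : ∀ t ∈ Icc (0 : ℝ) 1, HasDerivWithinAt γ (γ' t) (Icc 0 1) t ∧ ‖γ' t‖ ≤ C * ‖x - y‖ ∧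
      γ t ∈ U ∧ ‖fderiv ℝ g (γ t)‖ ≤ C * ‖x - y‖ ^ j)
    (hU : ∀ z ∈ U, DifferentiableAt ℝ g z) {t : ℝ} (ht : t ∈ Icc (0 : ℝ) 1) :
    ‖g (γ t) - g x‖ ≤ C ^ 2 * ‖x - y‖ ^ (j + 1) := by
  have hd : ∀ s ∈ Icc (0 : ℝ) 1,
      HasDerivWithinAt (fun s => g (γ s)) (fderiv ℝ g (γ s) (γ' s)) (Icc 0 1) s := fun s hs =>
    (hU _ (hγ s hs).2.2.1).hasFDerivAt.comp_hasDerivWithinAt s (hγ s hs).1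
  have hb : ∀ s ∈ Icc (0 : ℝ) 1, ‖fderiv ℝ g (γ s) (γ' s)‖ ≤ C ^ 2 * ‖x - y‖ ^ (j + 1) := by
    intro s hs
    obtain ⟨-, h1, -, h2⟩ := hγ s hs
    calc _ ≤ ‖fderiv ℝ g (γ s)‖ * ‖γ' s‖ := ContinuousLinearMap.le_opNorm _ _
      _ ≤ (C * ‖x - y‖ ^ j) * (C * ‖x - y‖) := by gcongr
      _ = _ := by ring
  have := (convex_Icc (0 : ℝ) 1).norm_image_sub_le_of_norm_hasDerivWithin_le hd hb
    (left_mem_Icc.2 zero_le_one) ht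
  rw [h0] at this
  refine this.trans ?_
  rw [Real.norm_eq_abs, sub_zero, abs_of_nonneg ht.1]
  exact mul_le_of_le_one_right (by positivity) ht.2

theorem CurveJoined.of_fderiv {U V : Set E} {φ : E → F} {j : ℕ} {C : ℝ} (hC : 0 ≤ C)
    {x y : E} (h : CurveJoined V (fderiv ℝ φ) j C x y) (hVU : V ⊆ U)
    (hV : ∀ z ∈ V, DifferentiableAt ℝ φ z) (hx : φ x = 0) :
    CurveJoined U φ (j + 1) (C + C ^ 2) x y := by
  obtain ⟨γ, γ', h0, h1, hγ⟩ := h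
  refine ⟨γ, γ', h0, h1, fun t ht => ⟨(hγ t ht).1, ?_, hVU (hγ t ht).2.2.1, ?_⟩⟩
  · refine (hγ t ht).2.1.trans ?_
    gcongr
    nlinarith
  · have := CurveJoined.norm_sub_le hC h0 hγ hV ht
    rw [hx, sub_zero] at this
    refine this.trans ?_
    gcongr
    nlinarith

theorem CurveJoined.image {E' : Type} [NormedAddCommGroup E'] [NormedSpace ℝ E']
    {U : Set E} {W : Set E'} {φ : E → F} {ψ : E' → E} {j : ℕ} {C D K : ℝ}
    (hC : 0 ≤ C) (hD : 0 ≤ D) {x y : E'}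
    (h : CurveJoined W (φ ∘ ψ) j C x y) (hWU : MapsTo ψ W U)
    (hψ : ∀ z ∈ W, DifferentiableAt ℝ ψ z ∧ ‖fderiv ℝ ψ z‖ ≤ D)
    (hxy : ‖x - y‖ ≤ K * ‖ψ x - ψ y‖) :
    CurveJoined U φ j (D * C * |K| + C * |K| ^ j) (ψ x) (ψ y) := by
  obtain ⟨γ, γ', h0, h1, hγ⟩ := h
  have hxy : ‖x - y‖ ≤ |K| * ‖ψ x - ψ y‖ :=
    hxy.trans (mul_le_mul_of_nonneg_right (le_abs_self K) (norm_nonneg _))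
  refine ⟨ψ ∘ γ, fun t => fderiv ℝ ψ (γ t) (γ' t), by simp [h0], by simp [h1], fun t ht => ?_⟩
  obtain ⟨g1, g2, g3, g4⟩ := hγ t ht
  obtain ⟨p1, p2⟩ := hψ _ g3
  refine ⟨p1.hasFDerivAt.comp_hasDerivWithinAt t g1, ?_, hWU g3, ?_⟩
  · calc _ ≤ ‖fderiv ℝ ψ (γ t)‖ * ‖γ' t‖ := ContinuousLinearMap.le_opNorm _ _
      _ ≤ D * (C * (|K| * ‖ψ x - ψ y‖)) := by gcongr; exact g2.trans (by gcongr)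
      _ = D * C * |K| * ‖ψ x - ψ y‖ := by ring
      _ ≤ _ := by gcongr; exact le_add_of_nonneg_right (by positivity)
  · calc _ ≤ C * ‖x - y‖ ^ j := g4
      _ ≤ C * (|K| * ‖ψ x - ψ y‖) ^ j := by gcongr
      _ = C * |K| ^ j * ‖ψ x - ψ y‖ ^ j := by ring
      _ ≤ _ := by gcongr; exact le_add_of_nonneg_left (by positivity)

theorem countablyCovered_of_isBigO [SecondCountableTopology E] {φ : E → F}
    {U A : Set E} (hU : IsOpen U) (hAU : A ⊆ U) (h0 : ∀ x ∈ A, φ x = 0)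
    (hreg : ∀ x ∈ A, ContDiffPointwiseHolderAt 0 1 φ x) :
    CountablyCovered (UniformlyCurveJoined U φ 1) A := by
  let T : ℕ → Set E := fun i => {x ∈ A | ∀ y ∈ ball x (1 / (i + 1 : ℝ)),
    y ∈ U ∧ ‖φ y‖ ≤ i * ‖y - x‖}
  have hT : A ⊆ ⋃ i, T i := by
    intro x hx
    have h1 := (ContDiffPointwiseHolderAt.zero_order_iff.1 (hreg x hx)).2
    simp only [h0 x hx, sub_zero, Set.Icc.coe_one, Real.rpow_one] at h1
    obtain ⟨c, hc⟩ := h1.bound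
    obtain ⟨r, hr, hb⟩ := Metric.eventually_nhds_iff_ball.1
      (hc.and (hU.eventually_mem (hAU hx)))
    obtain ⟨i, hi⟩ := exists_nat_gt (max c (1 / r))
    refine mem_iUnion.2 ⟨i, hx, fun y hy => ?_⟩
    have hir : 1 / (i + 1 : ℝ) ≤ r := by
      have : 1 / r < i := (le_max_right _ _).trans_lt hi
      rw [div_le_comm₀ (by positivity) hr]
      linarith
    obtain ⟨h2, h3⟩ := hb y (ball_subset_ball hir hy)
    refine ⟨h3, h2.trans ?_⟩
    rw [norm_norm]
    gcongr
    exact (le_max_left _ _).trans hi.le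
  refine (CountablyCovered.iUnion fun i => ?_).mono_set hT
  refine CountablyCovered.of_locally fun x _ => ⟨ball x (1 / (i + 1 : ℝ) / 2),
    ball_mem_nhds _ (by positivity), .of_mem ⟨i + 1, by positivity, ?_⟩⟩
  rintro a ⟨ha, ha'⟩ b ⟨hb, hb'⟩
  refine ⟨fun t => a + t • (b - a), fun _ => b - a, by simp, by simp, fun t ht => ?_⟩
  have hab : dist b a < 1 / (i + 1 : ℝ) := by
    have := dist_triangle_right b a x
    have h1 := mem_ball.1 ha'
    have h2 := mem_ball.1 hb'
    linarith
  have hta : ‖a + t • (b - a) - a‖ ≤ ‖a - b‖ := by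
    rw [add_sub_cancel_left, norm_smul, Real.norm_eq_abs, abs_of_nonneg ht.1, norm_sub_rev]
    exact mul_le_of_le_one_left (norm_nonneg _) ht.2
  obtain ⟨h1, h2⟩ := ha.2 (a + t • (b - a)) (by
    rw [mem_ball, dist_eq_norm]
    refine hta.trans_lt ?_
    rwa [norm_sub_rev, ← dist_eq_norm])
  refine ⟨?_, ?_, h1, ?_⟩
  · have := ((hasDerivAt_id t).smul_const (b - a)).const_add a
    simpa using this.hasDerivWithinAt
  · rw [norm_sub_rev]
    have : (0 : ℝ) ≤ i := by positivity
    nlinarith [norm_nonneg (a - b)]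
  · rw [pow_one]
    refine h2.trans ?_
    gcongr
    linarith

end Decomposition

section Morse

/-- Every vanishing set of a function of class `C^{j,1}` is a countable union of
pieces whose points are joined by curves along which the function is of order `j + 1`. -/
theorem countablyCovered_uniformlyCurveJoined (j : ℕ) : ∀ (N : ℕ) {E F : Type}
    [NormedAddCommGroup E] [NormedSpace ℝ E] [FiniteDimensional ℝ E]
    [NormedAddCommGroup F] [NormedSpace ℝ F] {φ : E → F} {U A : Set E},
    Module.finrank ℝ E = N → IsOpen U → A ⊆ U → (∀ x ∈ A, φ x = 0) →
    (∀ x ∈ A, ContDiffPointwiseHolderAt j 1 φ x) →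
    CountablyCovered (UniformlyCurveJoined U φ (j + 1)) A := by
  induction j with
  | zero =>
    intro N E F _ _ _ _ _ φ U A _ hU hAU h0 hreg
    have := FiniteDimensional.proper_real E
    exact countablyCovered_of_isBigO hU hAU h0 hreg
  | succ j ihj =>
    intro N
    induction N with
    | zero =>
      intro E F _ _ _ _ _ φ U A hN hU hAU h0 hreg
      have : Subsingleton E := Module.finrank_zero_iff.1 hN
      refine .of_mem ⟨0, le_rfl, fun x hx y hy => ⟨fun _ => x, fun _ => 0, rfl,
        Subsingleton.elim _ _, fun t _ => ⟨hasDerivWithinAt_const _ _ _, ?_, hAU hx, ?_⟩⟩⟩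
      · simp
      · simp [h0 x hx]
    | succ N ihN =>
      intro E F _ _ _ _ _ φ U A hN hU hAU h0 hreg
      have := FiniteDimensional.proper_real E
      have hdA : ∀ x ∈ A, ∀ᶠ y in 𝓝 x, DifferentiableAt ℝ φ y := by
        intro x hx
        have : ContDiffAt ℝ 1 φ x := (hreg x hx).contDiffAt.of_le (mod_cast Nat.succ_pos j)
        exact (this.eventually (by simp)).mono fun y hy => hy.differentiableAt one_ne_zero
      have hsplit : A = (A ∩ {x | fderiv ℝ φ x = 0}) ∪ (A ∩ {x | fderiv ℝ φ x ≠ 0}) := by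
        rw [← inter_union_distrib_left]
        ext x
        simp [em]
      rw [hsplit]
      refine .union ?_ ?_
      · let V := U ∩ interior {x | DifferentiableAt ℝ φ x}
        have := ihj (N + 1) (φ := fderiv ℝ φ) (U := V) (A := A ∩ {x | fderiv ℝ φ x = 0}) hN
          (hU.inter isOpen_interior)
          (fun x hx => ⟨hAU hx.1, mem_interior_iff_mem_nhds.2 (hdA x hx.1)⟩)
          (fun x hx => hx.2) (fun x hx => (hreg x hx.1).fderiv (Nat.lt_succ_self j))
        obtain ⟨T, hT, hAT, hP⟩ := this
        refine ⟨(fun S => S ∩ A) '' T, hT.image _, ?_, ?_⟩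
        · intro x hx
          obtain ⟨S, hS, hxS⟩ := hAT hx
          exact ⟨_, ⟨S, hS, rfl⟩, hxS, hx.1⟩
        · rintro _ ⟨S, hS, rfl⟩
          obtain ⟨C, hC, hJ⟩ := hP S hS
          refine ⟨C + C ^ 2, by positivity, fun x hx y hy => ?_⟩
          exact (hJ x hx.1 y hy.1).of_fderiv hC inter_subset_left
            (fun z hz => interior_subset (s := {x | DifferentiableAt ℝ φ x}) hz.2) (h0 x hx.2)
      · refine .of_locally fun x₀ hx₀ => ?_
        obtain ⟨hx₀A, hx₀d⟩ := hx₀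
        obtain ⟨v, hv⟩ : ∃ v, fderiv ℝ φ x₀ v ≠ 0 := by
          by_contra! H
          exact hx₀d (ContinuousLinearMap.ext H)
        obtain ⟨l, hl⟩ := SeparatingDual.exists_ne_zero (R := ℝ) hv
        let h : E → ℝ := l ∘ φ
        have hhreg : ∀ x ∈ A, ContDiffPointwiseHolderAt (j + 1) 1 h x := fun x hx =>
          (hreg x hx).continuousLinearMap_comp l
        have hhd : fderiv ℝ h x₀ ≠ 0 := by
          intro H
          have h1 : HasFDerivAt h (l.comp (fderiv ℝ φ x₀)) x₀ :=
            l.hasFDerivAt.comp x₀ ((hdA x₀ hx₀A).self_of_nhds).hasFDerivAt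
          rw [h1.fderiv] at H
          exact hl (by simpa using congrArg (fun L => L v) H)
        obtain ⟨E', π, Φ, C, hE', hxs, hΦ, hΦ1, hΦ2⟩ := exists_straightening
          ((hhreg x₀ hx₀A).contDiffAt.of_le (mod_cast Nat.succ_pos j)) hhd
        let ι : E' →L[ℝ] ℝ × E' := ContinuousLinearMap.inr ℝ ℝ E'
        let ψ : E' → E := fun v => Φ.symm (ι v)
        let W : Set E' := ι ⁻¹' (Φ.target ∩ Φ.symm ⁻¹' U)
        have hW : IsOpen W := (Φ.symm.isOpen_inter_preimage hU).preimage ι.continuous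
        have hψ : ∀ z ∈ W, HasFDerivAt ψ ((fderiv ℝ Φ.symm (ι z)).comp ι) z := fun z hz =>
          (((hΦ1 _ hz.1).1.differentiableAt one_ne_zero).hasFDerivAt).comp z ι.hasFDerivAt
        have hAΦ : ∀ x ∈ A ∩ Φ.source, ι (π x) = Φ x := by
          intro x hx
          rw [hΦ]
          simp [ι, h, h0 x hx.1]
        have hψπ : ∀ x ∈ A ∩ Φ.source, ψ (π x) = x := by
          intro x hx
          simp only [ψ]
          rw [hAΦ x hx, Φ.left_inv hx.2]
        let B : Set E' := W ∩ ψ ⁻¹' A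
        have hBreg : ∀ z ∈ B, ContDiffPointwiseHolderAt (j + 1) 1 (φ ∘ ψ) z := by
          intro z hz
          have h1 : ContDiffPointwiseHolderAt (j + 1) 1 Φ.symm (ι z) :=
            hΦ2 _ hz.1.1 _ (Nat.succ_ne_zero j) _ (hhreg _ hz.2)
          have h2 : ContDiffPointwiseHolderAt (j + 1) 1 ψ z :=
            h1.comp z ι.contDiffPointwiseHolderAt (Nat.succ_ne_zero j)
          exact (hreg _ hz.2).comp z h2 (Nat.succ_ne_zero j)
        obtain ⟨T, hT, hBT, hP⟩ := ihN (E := E') (φ := φ ∘ ψ) (U := W) (A := B) (by omega) hW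
          inter_subset_left (fun z hz => h0 _ hz.2) hBreg
        refine ⟨Φ.source, Φ.open_source.mem_nhds hxs,
          (fun S => A ∩ Φ.source ∩ π ⁻¹' S) '' T, hT.image _, ?_, ?_⟩
        · rintro x ⟨⟨hxA, -⟩, hxs⟩
          have hxB : π x ∈ B := by
            refine ⟨?_, ?_⟩
            · change ι (π x) ∈ Φ.target ∩ Φ.symm ⁻¹' U
              rw [hAΦ x ⟨hxA, hxs⟩]
              refine ⟨Φ.map_source hxs, ?_⟩
              rw [mem_preimage, Φ.left_inv hxs]
              exact hAU hxA
            · rw [mem_preimage, hψπ x ⟨hxA, hxs⟩]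
              exact hxA
          obtain ⟨S, hS, hxS⟩ := hBT hxB
          exact ⟨_, ⟨S, hS, rfl⟩, ⟨hxA, hxs⟩, hxS⟩
        · rintro _ ⟨S, hS, rfl⟩
          obtain ⟨c, hc, hJ⟩ := hP S hS
          have hC : 0 ≤ C := (norm_nonneg (fderiv ℝ Φ.symm (Φ x₀))).trans (hΦ1 _ (Φ.map_source hxs)).2
          refine ⟨C * ‖ι‖ * c * |‖π‖| + c * |‖π‖| ^ (j + 1 + 1), by positivity,
            fun x hx y hy => ?_⟩
          have := (hJ _ hx.2 _ hy.2).image (D := C * ‖ι‖) (K := ‖π‖) (U := U) hc (by positivity)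
            (fun z hz => hz.2) (fun z hz => ⟨(hψ z hz).differentiableAt, ?_⟩) ?_
          · rwa [hψπ x hx.1, hψπ y hy.1] at this
          · rw [(hψ z hz).fderiv]
            exact (ContinuousLinearMap.opNorm_comp_le _ _).trans
              (mul_le_mul_of_nonneg_right (hΦ1 _ hz.1).2 (norm_nonneg _))
          · rw [hψπ x hx.1, hψπ y hy.1, ← map_sub]
            exact π.le_opNorm _

/-- The critical points of rank zero of a function of class `C^{j+1,1}` are covered by countably
many sets on which the function is Hölder with exponent `j + 2`. -/
theorem countablyCovered_holder {E F : Type}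
    [NormedAddCommGroup E] [NormedSpace ℝ E] [FiniteDimensional ℝ E]
    [NormedAddCommGroup F] [NormedSpace ℝ F] {f : E → F} {A : Set E} {j : ℕ}
    (h0 : ∀ x ∈ A, fderiv ℝ f x = 0)
    (hreg : ∀ x ∈ A, ContDiffPointwiseHolderAt (j + 1) 1 f x) :
    CountablyCovered (fun S => ∃ C, 0 ≤ C ∧
      ∀ x ∈ S, ∀ y ∈ S, ‖f x - f y‖ ≤ C * ‖x - y‖ ^ (j + 2)) A := by
  refine (countablyCovered_uniformlyCurveJoined j _ (φ := fderiv ℝ f)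
    (U := interior {x | DifferentiableAt ℝ f x}) rfl isOpen_interior (fun x hx => ?_) h0
    fun x hx => (hreg x hx).fderiv (Nat.lt_succ_self j)).mono ?_
  · have : ContDiffAt ℝ 1 f x := (hreg x hx).contDiffAt.of_le (mod_cast Nat.succ_pos j)
    exact mem_interior_iff_mem_nhds.2
      ((this.eventually (by simp)).mono fun y hy => hy.differentiableAt one_ne_zero)
  · rintro S ⟨C, hC, hS⟩
    refine ⟨C ^ 2, by positivity, fun x hx y hy => ?_⟩
    obtain ⟨γ, γ', hγ0, hγ1, hγ⟩ := hS x hx y hy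
    have := CurveJoined.norm_sub_le hC hγ0 hγ
      (fun z hz => interior_subset (s := {x | DifferentiableAt ℝ f x}) hz)
      (right_mem_Icc.2 zero_le_one)
    rwa [hγ1, norm_sub_rev] at this

end Morse

section Holder

variable {E F : Type*} [NormedAddCommGroup E] [MeasurableSpace E] [BorelSpace E]
  [NormedAddCommGroup F]

theorem hausdorffMeasure_image_le_of_norm_sub_le [MeasurableSpace F] [BorelSpace F]
    {f : E → F} {S : Set E} {k m : ℕ} {C : ℝ}
    (hC : 0 ≤ C) (hk : 0 < k) (hf : ∀ x ∈ S, ∀ y ∈ S, ‖f x - f y‖ ≤ C * ‖x - y‖ ^ k) :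
    μH[m] (f '' S) ≤ ENNReal.ofReal C ^ m * μH[(k * m : ℕ)] S := by
  have h : HolderOnWith C.toNNReal k f S := by
    intro x hx y hy
    have := hf x hx y hy
    rw [← dist_eq_norm, ← dist_eq_norm] at this
    rw [edist_dist, edist_dist, NNReal.coe_natCast, ENNReal.rpow_natCast, ← ENNReal.ofReal_pow
      dist_nonneg, ← ENNReal.ofReal, ← ENNReal.ofReal_mul hC]
    exact ENNReal.ofReal_le_ofReal this
  have := h.hausdorffMeasure_image_le (d := m) (by exact_mod_cast hk) (by positivity)
  simpa [ENNReal.ofReal] using this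

variable [NormedSpace ℝ E] [FiniteDimensional ℝ E]

/-- Near a density point `x` of `S`, the set `S` is `η * r`-dense in the ball of radius `r`
around `x`. -/
theorem eventually_exists_mem_of_density (μ : Measure E) [μ.IsAddHaarMeasure] {S : Set E} {x : E}
    (h : Tendsto (fun r => μ (S ∩ closedBall x r) / μ (closedBall x r)) (𝓝[>] 0) (𝓝 1))
    {η : ℝ} (hη : 0 < η) (hη1 : η ≤ 1) :
    ∀ᶠ r in 𝓝[>] (0 : ℝ), ∀ z, ‖z - x‖ ≤ r → ∃ w ∈ S, ‖w - z‖ ≤ η * r := by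
  set N := Module.finrank ℝ E
  set θ : ℝ := (η / 2) ^ N with hθ
  have hθ0 : 0 < θ := by positivity
  have h2 : Tendsto (fun r : ℝ => 2 * r) (𝓝[>] 0) (𝓝[>] 0) := by
    refine tendsto_nhdsWithin_iff.2 ⟨?_, ?_⟩
    · have : Tendsto (fun r : ℝ => 2 * r) (𝓝 0) (𝓝 (2 * 0)) := tendsto_id.const_mul 2
      rw [mul_zero] at this
      exact this.mono_left nhdsWithin_le_nhds
    · filter_upwards [self_mem_nhdsWithin] with r hr
      exact mul_pos two_pos (mem_Ioi.1 hr)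
  have h3 := (h.comp h2).add_const (ENNReal.ofReal θ)
  have h4 : (1 : ℝ≥0∞) < 1 + ENNReal.ofReal θ :=
    ENNReal.lt_add_right ENNReal.one_ne_top (by simpa using hθ0)
  filter_upwards [h3.eventually (lt_mem_nhds h4), self_mem_nhdsWithin] with r hr hr0 z hz
  have hr0 : 0 < r := hr0
  by_contra! H
  have hsub : closedBall z (η * r) ⊆ closedBall x (2 * r) := by
    apply closedBall_subset_closedBall'
    rw [dist_eq_norm]
    nlinarith
  have hdisj : Disjoint (S ∩ closedBall x (2 * r)) (closedBall z (η * r)) := by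
    rw [Set.disjoint_left]
    rintro w ⟨hw, -⟩ hw'
    rw [mem_closedBall, dist_eq_norm] at hw'
    exact (H w hw).not_ge hw'
  have hsum : μ (S ∩ closedBall x (2 * r)) + μ (closedBall z (η * r)) ≤ μ (closedBall x (2 * r)) := by
    rw [← measure_union hdisj measurableSet_closedBall]
    exact measure_mono (union_subset inter_subset_right hsub)
  have hsmall : μ (closedBall z (η * r)) = ENNReal.ofReal θ * μ (closedBall x (2 * r)) := by
    rw [μ.addHaar_closedBall _ (by positivity), μ.addHaar_closedBall _ (by positivity),
      ← mul_assoc, ← ENNReal.ofReal_mul hθ0.le, hθ, ← mul_pow]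
    congr 3
    ring
  have hB0 : μ (closedBall x (2 * r)) ≠ 0 := (measure_closedBall_pos μ x (by positivity)).ne'
  have hBt : μ (closedBall x (2 * r)) ≠ ∞ := measure_closedBall_lt_top.ne
  have := ENNReal.div_le_div_right hsum (μ (closedBall x (2 * r)))
  rw [ENNReal.div_self hB0 hBt, hsmall, ENNReal.add_div, ENNReal.mul_div_cancel_right hB0 hBt]
    at this
  exact this.not_gt hr

/-- At a density point of `S`, a map which is Hölder on `S` with exponent `k ≥ 2` satisfies the
Hölder estimate with an arbitrarily small constant. -/
theorem exists_norm_sub_le_of_density (μ : Measure E) [μ.IsAddHaarMeasure] {f : E → F}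
    {S : Set E} {k : ℕ} {C : ℝ} (hC : 0 ≤ C) (hk : 2 ≤ k)
    (hf : ∀ x ∈ S, ∀ y ∈ S, ‖f x - f y‖ ≤ C * ‖x - y‖ ^ k) {x : E} (hx : x ∈ S)
    (h : Tendsto (fun r => μ (S ∩ closedBall x r) / μ (closedBall x r)) (𝓝[>] 0) (𝓝 1))
    {ε : ℝ} (hε : 0 < ε) :
    ∃ δ > 0, ∀ y ∈ S, ‖x - y‖ < δ → ‖f x - f y‖ ≤ ε * ‖x - y‖ ^ k := by
  obtain ⟨p, hp⟩ := exists_nat_gt (max 1 (C * 3 ^ k / ε))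
  have hp1 : (1 : ℝ) < p := (le_max_left _ _).trans_lt hp
  have hp0 : (0 : ℝ) < p := zero_lt_one.trans hp1
  have hpε : C * 3 ^ k ≤ ε * p := by
    have := ((le_max_right _ _).trans_lt hp).le
    rwa [div_le_iff₀ hε, mul_comm (p : ℝ)] at this
  have := eventually_exists_mem_of_density μ h (η := 1 / p) (by positivity)
    ((div_le_one hp0).2 hp1.le)
  obtain ⟨δ, hδ, hd⟩ := (mem_nhdsGT_iff_exists_Ioo_subset).1 this
  refine ⟨δ, hδ, fun y hy hxy => ?_⟩
  rcases eq_or_ne x y with rfl | hne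
  · simp only [sub_self, norm_zero]; positivity
  set r := ‖x - y‖ with hr
  have hr0 : 0 < r := norm_pos_iff.2 (sub_ne_zero.2 hne)
  have hw : ∀ i : ℕ, ∃ w, i ≤ p → w ∈ S ∧ ‖w - (x + (i / p : ℝ) • (y - x))‖ ≤ 1 / p * r ∧
      (i = 0 → w = x) ∧ (i = p → w = y) := by
    intro i
    by_cases hi0 : i = 0
    · refine ⟨x, fun _ => ⟨hx, ?_, fun _ => rfl, fun hip => ?_⟩⟩
      · simp only [hi0, Nat.cast_zero, zero_div, zero_smul, add_zero, sub_self, norm_zero]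
        positivity
      · rw [← hip, hi0] at hp0; simp at hp0
    by_cases hip : i = p
    · refine ⟨y, fun _ => ⟨hy, ?_, fun h => absurd h hi0, fun _ => rfl⟩⟩
      rw [hip, div_self hp0.ne', one_smul, add_sub_cancel, sub_self, norm_zero]
      positivity
    by_cases hle : i ≤ p
    · obtain ⟨w, hwS, hw⟩ := hd ⟨hr0, hxy⟩ (x + (i / p : ℝ) • (y - x)) (by
        rw [add_sub_cancel_left, norm_smul, norm_sub_rev y x, Real.norm_of_nonneg (by positivity)]
        exact mul_le_of_le_one_left hr0.le ((div_le_one hp0).2 (mod_cast hle)))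
      exact ⟨w, fun _ => ⟨hwS, hw, fun h => absurd h hi0, fun h => absurd h hip⟩⟩
    · exact ⟨x, fun h => absurd h hle⟩
  choose w hw using hw
  have hstep : ∀ {i}, i < p → dist (f (w i)) (f (w (i + 1))) ≤ C * (3 * r / p) ^ k := by
    intro i hi
    obtain ⟨s1, n1, -⟩ := hw i hi.le
    obtain ⟨s2, n2, -⟩ := hw (i + 1) hi
    rw [dist_eq_norm]
    refine (hf _ s1 _ s2).trans ?_
    gcongr
    have e : w i - w (i + 1) = (w i - (x + (i / p : ℝ) • (y - x)))
        - (w (i + 1) - (x + ((i + 1 : ℕ) / p : ℝ) • (y - x))) - (1 / p : ℝ) • (y - x) := by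
      push_cast
      module
    have n3 : ‖(1 / p : ℝ) • (y - x)‖ = 1 / p * r := by
      rw [norm_smul, norm_sub_rev y x, Real.norm_of_nonneg (by positivity)]
    rw [e]
    refine (norm_sub_le _ _).trans ?_
    have := norm_sub_le (w i - (x + (i / p : ℝ) • (y - x)))
      (w (i + 1) - (x + ((i + 1 : ℕ) / p : ℝ) • (y - x)))
    rw [n3]
    have e2 : 3 * r / p = 1 / p * r + 1 / p * r + 1 / p * r := by ring
    rw [e2]
    linarith
  have := dist_le_range_sum_of_dist_le (f := f ∘ w) p (d := fun _ => C * (3 * r / p) ^ k) hstep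
  simp only [Function.comp_apply, Finset.sum_const, Finset.card_range, nsmul_eq_mul] at this
  rw [(hw 0 (Nat.zero_le _)).2.2.1 rfl, (hw p le_rfl).2.2.2 rfl, dist_eq_norm] at this
  refine this.trans ?_
  obtain ⟨q, rfl⟩ := Nat.exists_eq_add_of_le hk
  have hpq : (p : ℝ) * p ≤ p ^ (2 + q) := by
    rw [← sq]; exact pow_le_pow_right₀ hp1.le (by omega)
  rw [div_pow, mul_pow, ← mul_div_assoc, ← mul_div_assoc, div_le_iff₀ (by positivity)]
  calc p * (C * (3 ^ (2 + q) * r ^ (2 + q))) = p * (C * 3 ^ (2 + q)) * r ^ (2 + q) := by ring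
    _ ≤ p * (ε * p) * r ^ (2 + q) := by gcongr
    _ = ε * r ^ (2 + q) * (p * p) := by ring
    _ ≤ _ := by gcongr

end Holder

section HolderNull

variable {E F : Type*} [NormedAddCommGroup E] [NormedSpace ℝ E] [FiniteDimensional ℝ E]
  [MeasurableSpace E] [BorelSpace E]
  [NormedAddCommGroup F] [MeasurableSpace F] [BorelSpace F]

/-- Countable subadditivity for a locally valid bound on the Hausdorff measure of images. -/
theorem hausdorffMeasure_image_le_of_locally_norm_sub_le (μ : Measure E) {f : E → F} {T : Set E}
    {k m : ℕ} {ε δ : ℝ} (hε : 0 ≤ ε) (hδ : 0 < δ) (hk : 0 < k)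
    (hμ : μ = μH[(k * m : ℕ)])
    (hf : ∀ x ∈ T, ∀ y ∈ T, ‖x - y‖ < δ → ‖f x - f y‖ ≤ ε * ‖x - y‖ ^ k) :
    μH[m] (f '' T) ≤ ENNReal.ofReal ε ^ m * μ T := by
  have := FiniteDimensional.proper_real E
  let P : ℕ → Set E := disjointed fun q => ball (TopologicalSpace.denseSeq E q) (δ / 2)
  have hPm : ∀ q, MeasurableSet (P q) := .disjointed fun q => measurableSet_ball
  have hPU : ⋃ q, P q = univ := by
    rw [iUnion_disjointed, eq_univ_iff_forall]
    intro x
    obtain ⟨q, hq⟩ := (TopologicalSpace.denseRange_denseSeq E).exists_dist_lt x (half_pos hδ)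
    exact mem_iUnion.2 ⟨q, hq⟩
  have hT : f '' T = ⋃ q, f '' (T ∩ P q) := by
    rw [← image_iUnion, ← inter_iUnion, hPU, inter_univ]
  calc μH[m] (f '' T) ≤ ∑' q, μH[m] (f '' (T ∩ P q)) := by
        rw [hT]; exact measure_iUnion_le _
    _ ≤ ∑' q, ENNReal.ofReal ε ^ m * μ.restrict T (P q) := by
        refine ENNReal.tsum_le_tsum fun q => ?_
        rw [Measure.restrict_apply (hPm q), inter_comm (P q), hμ]
        refine hausdorffMeasure_image_le_of_norm_sub_le hε hk fun x hx y hy => ?_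
        refine hf x hx.1 y hy.1 ?_
        have h1 := mem_ball.1 (disjointed_subset (fun q => ball (TopologicalSpace.denseSeq E q) (δ / 2)) q hx.2)
        have h2 := mem_ball.1 (disjointed_subset (fun q => ball (TopologicalSpace.denseSeq E q) (δ / 2)) q hy.2)
        have := dist_triangle_right x y (TopologicalSpace.denseSeq E q)
        rw [← dist_eq_norm]
        linarith
    _ = ENNReal.ofReal ε ^ m * μ.restrict T (⋃ q, P q) := by
        rw [ENNReal.tsum_mul_left, measure_iUnion (disjoint_disjointed _) hPm]
    _ = _ := by rw [hPU, Measure.restrict_apply_univ]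

theorem hausdorffMeasure_image_density_eq_zero {f : E → F} {S : Set E} {k m : ℕ}
    {C : ℝ} (hC : 0 ≤ C) (hk : 2 ≤ k) (hm : 0 < m) (hN : Module.finrank ℝ E = k * m)
    (hS : Bornology.IsBounded S)
    (hf : ∀ x ∈ S, ∀ y ∈ S, ‖f x - f y‖ ≤ C * ‖x - y‖ ^ k) :
    μH[m] (f '' S) = 0 := by
  have := FiniteDimensional.proper_real E
  let μ : Measure E := μH[Module.finrank ℝ E]
  have hμ : μ = μH[(k * m : ℕ)] := by simp only [μ, hN]
  let D : Set E := {x | Tendsto (fun r => μ (S ∩ closedBall x r) / μ (closedBall x r))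
    (𝓝[>] 0) (𝓝 1)}
  have hfin : μ S ≠ ∞ := hS.measure_lt_top.ne
  have h1 : μH[m] (f '' (S ∩ Dᶜ)) = 0 := by
    have h2 : μ (S ∩ Dᶜ) = 0 := by
      have := Besicovitch.ae_tendsto_measure_inter_div μ S
      rw [inter_comm]
      exact le_antisymm ((Measure.le_restrict_apply _ _).trans (le_of_eq this)) zero_le
    have := hausdorffMeasure_image_le_of_norm_sub_le (S := S ∩ Dᶜ) (m := m) hC (by omega)
      fun x hx y hy => hf x hx.1 y hy.1
    rw [← hμ, h2, mul_zero] at this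
    exact le_antisymm this zero_le
  have h2 : ∀ ε > 0, μH[m] (f '' (S ∩ D)) ≤ ENNReal.ofReal ε ^ m * μ S := by
    intro ε hε
    let T : ℕ → Set E := fun i => {x ∈ S | ∀ y ∈ S, ‖x - y‖ < 1 / (i + 1 : ℝ) →
      ‖f x - f y‖ ≤ ε * ‖x - y‖ ^ k}
    have hTm : Monotone T := fun i i' hi x hx => ⟨hx.1, fun y hy hxy =>
      hx.2 y hy (hxy.trans_le (Nat.one_div_le_one_div hi))⟩
    have hTD : S ∩ D ⊆ ⋃ i, T i := by
      rintro x ⟨hxS, hxD⟩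
      obtain ⟨δ, hδ, h⟩ := exists_norm_sub_le_of_density μ hC hk hf hxS hxD hε
      obtain ⟨i, hi⟩ := exists_nat_one_div_lt hδ
      exact mem_iUnion.2 ⟨i, hxS, fun y hy hxy => h y hy (hxy.trans hi)⟩
    calc μH[m] (f '' (S ∩ D)) ≤ μH[m] (⋃ i, f '' T i) := by
          rw [← image_iUnion]; exact measure_mono (image_mono hTD)
      _ = ⨆ i, μH[m] (f '' T i) :=
          Monotone.measure_iUnion fun i i' hi => image_mono (hTm hi)
      _ ≤ ENNReal.ofReal ε ^ m * μ S := iSup_le fun i =>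
          (hausdorffMeasure_image_le_of_locally_norm_sub_le μ hε.le
            (Nat.one_div_pos_of_nat (n := i)) (by omega) hμ
            fun x hx y hy => hx.2 y hy.1).trans
            (mul_le_mul_right (measure_mono fun x hx => hx.1) _)
  have h3 : μH[m] (f '' (S ∩ D)) = 0 := by
    refine le_antisymm ?_ zero_le
    have hlim : Tendsto (fun ε : ℝ => ENNReal.ofReal ε ^ m * μ S) (𝓝[>] 0) (𝓝 0) := by
      have h4 : Tendsto (fun ε : ℝ => ENNReal.ofReal ε ^ m) (𝓝 0) (𝓝 0) := by
        have := ((ENNReal.continuous_ofReal.tendsto 0).ennrpow_const (m : ℝ))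
        simpa [hm.ne', hm] using this
      have := ENNReal.Tendsto.mul_const h4 (Or.inr hfin)
      rw [zero_mul] at this
      exact this.mono_left nhdsWithin_le_nhds
    exact ge_of_tendsto hlim (by
      filter_upwards [self_mem_nhdsWithin] with ε hε using h2 ε hε)
  rw [← inter_union_compl S D, image_union]
  exact measure_union_null h3 h1

/-- A map which is Hölder with exponent `k ≥ 2` on a subset `S` of a space of dimension at most
`k * m` maps `S` to a set of vanishing `m`-dimensional measure. -/
theorem hausdorffMeasure_image_eq_zero_of_norm_sub_le {f : E → F} {S : Set E} {k m : ℕ}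
    {C : ℝ} (hC : 0 ≤ C) (hk : 2 ≤ k) (hm : 0 < m) (hN : Module.finrank ℝ E ≤ k * m)
    (hf : ∀ x ∈ S, ∀ y ∈ S, ‖f x - f y‖ ≤ C * ‖x - y‖ ^ k) :
    μH[m] (f '' S) = 0 := by
  rcases hN.lt_or_eq with hN | hN
  · have h0 : μH[(k * m : ℕ)] S = 0 := by
      have h1 : dimH S < ((k * m : ℕ) : ℝ≥0) := by
        refine (dimH_mono (subset_univ S)).trans_lt ?_
        rw [Real.dimH_univ_eq_finrank]
        exact_mod_cast hN
      have := hausdorffMeasure_of_dimH_lt h1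
      simpa using this
    have := hausdorffMeasure_image_le_of_norm_sub_le (m := m) hC (by omega) hf
    rw [h0, mul_zero] at this
    exact le_antisymm this zero_le
  · rw [← iUnion_inter_closedBall_nat S 0, image_iUnion, measure_iUnion_null_iff]
    exact fun i => hausdorffMeasure_image_density_eq_zero hC hk hm hN
      (isBounded_closedBall.subset inter_subset_right) fun x hx y hy => hf x hx.1 y hy.1

end HolderNull

section Sard

theorem IsSigmaCompact.inter_isClosed {X : Type*} [TopologicalSpace X] {s t : Set X}
    (hs : IsSigmaCompact s) (ht : IsClosed t) : IsSigmaCompact (s ∩ t) := by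
  obtain ⟨K, hK, rfl⟩ := hs
  rw [iUnion_inter]
  exact isSigmaCompact_iUnion_of_isCompact _ fun i => (hK i).inter_right ht

theorem IsSigmaCompact.measurableSet {X : Type*} [TopologicalSpace X] [T2Space X]
    [MeasurableSpace X] [BorelSpace X] {s : Set X} (hs : IsSigmaCompact s) : MeasurableSet s := by
  obtain ⟨K, hK, rfl⟩ := hs
  exact .iUnion fun i => (hK i).measurableSet

theorem CountablyCovered.measure_image_eq_zero {X Y : Type*} [MeasurableSpace Y]
    {μ : Measure Y} {f : X → Y} {A : Set X}
    (h : CountablyCovered (fun S => μ (f '' S) = 0) A) : μ (f '' A) = 0 := by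
  obtain ⟨T, hT, hA, hP⟩ := h
  refine measure_mono_null (image_mono hA) ?_
  rw [sUnion_eq_biUnion, image_iUnion₂]
  exact (measure_biUnion_null_iff hT).2 hP

/-- A nonzero continuous linear functional splits off a line. -/
theorem exists_continuousLinearEquiv_prod_ker {F : Type*} [NormedAddCommGroup F]
    [NormedSpace ℝ F] {l : F →L[ℝ] ℝ} {e : F} (he : l e ≠ 0) :
    ∃ L : F ≃L[ℝ] ℝ × l.ker, ∀ y, (L y).1 = l y :=
  ⟨.equivOfRightInverse l (.toSpanSingleton ℝ ((l e)⁻¹ • e)) fun r => by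
    simp [ContinuousLinearMap.toSpanSingleton_apply, he], fun y => rfl⟩

/-- Fubini's theorem for null sets, in terms of Hausdorff measures. -/
theorem hausdorffMeasure_prod_eq_zero {G : Type*} [NormedAddCommGroup G] [NormedSpace ℝ G]
    [FiniteDimensional ℝ G] [MeasurableSpace G] [BorelSpace G] {m : ℕ}
    (hG : Module.finrank ℝ G = m) {S : Set (ℝ × G)} (hS : MeasurableSet S)
    (h : ∀ u, μH[m] (Prod.mk u ⁻¹' S) = 0) : μH[(m + 1 : ℕ)] S = 0 := by
  have hd : Module.finrank ℝ (ℝ × G) = m + 1 := by simp [hG, add_comm]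
  subst hG
  rw [← hd]
  have h1 : ((volume : Measure ℝ).prod (μH[Module.finrank ℝ G] : Measure G)) S = 0 := by
    rw [Measure.measure_prod_null hS]
    exact .of_forall h
  exact Measure.absolutelyContinuous_isAddHaarMeasure _ _ h1

/-- **Bates' version of the Morse-Sard theorem** on a σ-compact set: the critical values of a map
`ℝ^(m+j+1) → ℝ^m` of class `C^{j+1,1}` form a null set. -/
theorem hausdorffMeasure_image_eq_zero_of_not_surjective (j : ℕ) :
    ∀ (m : ℕ) {E F : Type} [NormedAddCommGroup E] [NormedSpace ℝ E] [FiniteDimensional ℝ E]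
      [NormedAddCommGroup F] [NormedSpace ℝ F] [FiniteDimensional ℝ F]
      [MeasurableSpace F] [BorelSpace F] {f : E → F} {A : Set E},
      Module.finrank ℝ E = m + (j + 1) → Module.finrank ℝ F = m → IsSigmaCompact A →
      (∀ x ∈ A, ContDiffPointwiseHolderAt (j + 1) 1 f x) →
      (∀ x ∈ A, ¬ Function.Surjective (fderiv ℝ f x)) → μH[m] (f '' A) = 0 := by
  intro m
  induction m with
  | zero =>
    intro E F _ _ _ _ _ _ _ _ f A _ hF _ _ hcrit
    have := Module.finrank_zero_iff.1 hF
    have : A = ∅ := eq_empty_of_forall_notMem fun x hx =>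
      hcrit x hx (Function.surjective_to_subsingleton _)
    simp [this]
  | succ m ih =>
    intro E F _ _ _ _ _ _ _ _ f A hE hF hA hreg hcrit
    have := FiniteDimensional.proper_real E
    borelize E
    apply CountablyCovered.measure_image_eq_zero
    have hsplit : A = (A ∩ {x | fderiv ℝ f x = 0}) ∪ (A ∩ {x | fderiv ℝ f x = 0}ᶜ) :=
      (inter_union_compl _ _).symm
    rw [hsplit]
    refine .union ?_ (.of_locally ?_)
    · refine (countablyCovered_holder (j := j) (fun x hx => hx.2)
        fun x hx => hreg x hx.1).mono ?_
      rintro S ⟨C, hC, hS⟩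
      refine hausdorffMeasure_image_eq_zero_of_norm_sub_le hC (by omega) (by omega) ?_ hS
      rw [hE]
      nlinarith [Nat.zero_le (j * m)]
    rintro x₀ ⟨hx₀A, hx₀⟩
    obtain ⟨v, hv⟩ : ∃ v, fderiv ℝ f x₀ v ≠ 0 := by
      by_contra! h
      exact hx₀ (ContinuousLinearMap.ext h)
    obtain ⟨l, hl⟩ := SeparatingDual.exists_ne_zero (R := ℝ) hv
    obtain ⟨L, hL⟩ := exists_continuousLinearEquiv_prod_ker hl
    have hl' : ∀ x ∈ A, HasFDerivAt (l ∘ f) (l ∘L fderiv ℝ f x) x := fun x hx =>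
      l.hasFDerivAt.comp x ((hreg x hx).differentiableAt (by omega)).hasFDerivAt
    obtain ⟨E', π, Φ, C, hE', hx₀Φ, hΦ, -, hΦreg⟩ := exists_straightening (h := l ∘ f) (x₀ := x₀)
      (l.contDiff.contDiffAt.comp x₀ ((hreg x₀ hx₀A).contDiffAt.of_le (by
        norm_cast; omega))) (by
        rw [(hl' x₀ hx₀A).fderiv]
        exact fun h => hl (by simpa using DFunLike.congr_fun h v))
    obtain ⟨K, hK, hKΦ, hKc⟩ := local_compact_nhds (Φ.open_source.mem_nhds hx₀Φ)
    refine ⟨K, hK, (CountablyCovered.of_mem (A := A ∩ K) ?_).mono_set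
      (inter_subset_inter_left _ inter_subset_left)⟩
    have hTΦ : A ∩ K ⊆ Φ.source := inter_subset_right.trans hKΦ
    have hT : IsSigmaCompact (A ∩ K) := hA.inter_isClosed hKc.isClosed
    have hf : ContinuousOn f (A ∩ K) := fun x hx =>
      (hreg x hx.1).continuousAt.continuousWithinAt
    have hS : IsSigmaCompact (L '' (f '' (A ∩ K))) :=
      (hT.image_of_continuousOn hf).image L.continuous
    have hker : Module.finrank ℝ l.ker = m := by
      have := L.toLinearEquiv.finrank_eq
      rw [hF, Module.finrank_prod, Module.finrank_self] at this
      omega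
    have hnull : μH[(m + 1 : ℕ)] (L '' (f '' (A ∩ K))) = 0 := by
      refine hausdorffMeasure_prod_eq_zero hker hS.measurableSet fun u => ?_
      let B : Set E' := Prod.snd '' (Φ '' (A ∩ K) ∩ {p | p.1 = u})
      let g : E' → l.ker := fun v => (L (f (Φ.symm (u, v)))).2
      have hB : ∀ v ∈ B, ∃ x ∈ A ∩ K, Φ x = (u, v) := by
        rintro v ⟨⟨u', v'⟩, ⟨⟨x, hx, hxΦ⟩, rfl⟩, rfl⟩
        exact ⟨x, hx, hxΦ⟩
      have hsub : Prod.mk u ⁻¹' (L '' (f '' (A ∩ K))) ⊆ g '' B := by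
        rintro w ⟨_, ⟨x, hx, rfl⟩, hxw⟩
        have hu : l (f x) = u := by rw [← hL, hxw]
        have hxΦ : Φ x = (u, π x) := by rw [hΦ, Function.comp_apply, hu]
        refine ⟨π x, ⟨Φ x, ⟨mem_image_of_mem _ hx, by simp [hxΦ]⟩, by simp [hxΦ]⟩, ?_⟩
        simp only [g]
        rw [← hxΦ, Φ.left_inv (hTΦ hx), hxw]
      refine measure_mono_null hsub (ih (by omega) hker ?_ ?_ ?_)
      · exact ((hT.image_of_continuousOn (Φ.continuousOn.mono hTΦ)).inter_isClosed
          (isClosed_eq continuous_fst continuous_const)).image continuous_snd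
      · intro v hv
        obtain ⟨x, hx, hxv⟩ := hB v hv
        have hmem : (u, v) ∈ Φ.target := hxv ▸ Φ.map_source (hTΦ hx)
        have hx' : Φ.symm (u, v) = x := by rw [← hxv, Φ.left_inv (hTΦ hx)]
        have h1 : ContDiffPointwiseHolderAt (j + 1) 1 Φ.symm (u, v) := by
          refine hΦreg _ hmem _ (by omega) _ ?_
          rw [hx']
          exact (hreg x hx.1).continuousLinearMap_comp l
        have h2 : ContDiffPointwiseHolderAt (j + 1) 1 (fun v : E' => (u, v)) v :=
          (contDiff_prodMk_right u).contDiffAt.contDiffPointwiseHolderAt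
            (WithTop.coe_lt_top _) 1 (n := ⊤)
        have h3 : ContDiffPointwiseHolderAt (j + 1) 1 (fun v : E' => Φ.symm (u, v)) v :=
          ContDiffPointwiseHolderAt.comp v h1 h2 (by omega)
        have h4 : ContDiffPointwiseHolderAt (j + 1) 1 (fun v : E' => f (Φ.symm (u, v))) v :=
          ContDiffPointwiseHolderAt.comp v (by rw [hx']; exact hreg x hx.1) h3 (by omega)
        exact h4.continuousLinearMap_comp
          (ContinuousLinearMap.snd ℝ ℝ l.ker ∘L (L : F →L[ℝ] ℝ × l.ker))
      · intro v hv hsurj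
        obtain ⟨x, hx, hxv⟩ := hB v hv
        have hmem : (u, v) ∈ Φ.target := hxv ▸ Φ.map_source (hTΦ hx)
        have hx' : Φ.symm (u, v) = x := by rw [← hxv, Φ.left_inv (hTΦ hx)]
        have hΦd : DifferentiableAt ℝ Φ.symm (u, v) := by
          refine (hΦreg _ hmem (j + 1) (by omega) 1 ?_).differentiableAt (by omega)
          rw [hx']
          exact (hreg x hx.1).continuousLinearMap_comp l
        have hfd : HasFDerivAt f (fderiv ℝ f x) (Φ.symm (u, v)) := by
          rw [hx']
          exact ((hreg x hx.1).differentiableAt (by omega)).hasFDerivAt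
        let D := fderiv ℝ Φ.symm (u, v)
        have hG : HasFDerivAt (fun p => L (f (Φ.symm p)))
            ((L : F →L[ℝ] ℝ × l.ker) ∘L (fderiv ℝ f x ∘L D)) (u, v) :=
          (L : F →L[ℝ] ℝ × l.ker).hasFDerivAt.comp (u, v) (hfd.comp (u, v) hΦd.hasFDerivAt)
        have hfst : ∀ p, (L (fderiv ℝ f x (D p))).1 = p.1 := by
          have h1 : HasFDerivAt (fun p => (L (f (Φ.symm p))).1)
              (ContinuousLinearMap.fst ℝ ℝ l.ker ∘L
                ((L : F →L[ℝ] ℝ × l.ker) ∘L (fderiv ℝ f x ∘L D))) (u, v) :=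
            (ContinuousLinearMap.fst ℝ ℝ l.ker).hasFDerivAt.comp (u, v) hG
          have h2 : (fun p => (L (f (Φ.symm p))).1) =ᶠ[𝓝 (u, v)] Prod.fst := by
            filter_upwards [Φ.open_target.mem_nhds hmem] with p hp
            have := congr_arg Prod.fst (Φ.right_inv hp)
            rw [hΦ] at this
            rw [hL]
            exact this
          have h3 := (h1.congr_of_eventuallyEq h2.symm).unique (hasFDerivAt_fst (𝕜 := ℝ))
          exact fun p => DFunLike.congr_fun h3 p
        have hsnd : fderiv ℝ g v = ContinuousLinearMap.snd ℝ ℝ l.ker ∘L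
            ((L : F →L[ℝ] ℝ × l.ker) ∘L (fderiv ℝ f x ∘L D)) ∘L
              ContinuousLinearMap.inr ℝ ℝ E' := by
          have h1 := hG.comp v (hasFDerivAt_prodMk_right u v)
          exact ((ContinuousLinearMap.snd ℝ ℝ l.ker).hasFDerivAt.comp v h1).fderiv
        refine hcrit x hx.1 fun y => ?_
        let a := (L y).1
        obtain ⟨w, hw⟩ := hsurj ((L y).2 - (L (fderiv ℝ f x (D (a, 0)))).2)
        refine ⟨D (a, w), L.injective (Prod.ext (hfst _) ?_)⟩
        have h1 : (L (fderiv ℝ f x (D (0, w)))).2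
            = (L y).2 - (L (fderiv ℝ f x (D (a, 0)))).2 := by
          rw [← hw, hsnd]; rfl
        have h2 : ((a, w) : ℝ × E') = (a, 0) + (0, w) := by simp
        rw [h2, map_add, map_add, map_add, Prod.snd_add, h1]
        abel
    have h1 := L.symm.lipschitz.hausdorffMeasure_image_le (d := ((m + 1 : ℕ) : ℝ))
      (Nat.cast_nonneg _) (L '' (f '' (A ∩ K)))
    rw [hnull, mul_zero, L.symm_image_image] at h1
    exact le_antisymm h1 zero_le

end Sard

end Auxiliary

section CriticalValues

variable {n m : ℕ}

theorem derivRank_lt_iff {f : Ec n → Ec m} {x : Ec n} :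
    derivRank f x < m ↔ ¬ Function.Surjective (fderiv ℝ f x) := by
  have hle : derivRank f x ≤ m := by
    have := Submodule.finrank_le
      (LinearMap.range ((fderiv ℝ f x : Ec n →L[ℝ] Ec m) : Ec n →ₗ[ℝ] Ec m))
    rwa [finrank_euclideanSpace_fin] at this
  rw [← not_iff_not, not_lt, not_not]
  constructor
  · intro h
    have h1 := Submodule.eq_top_of_finrank_eq
      (show derivRank f x = Module.finrank ℝ (Ec m) by simpa using le_antisymm hle h)
    exact LinearMap.range_eq_top.1 h1
  · intro h
    have h1 : LinearMap.range ((fderiv ℝ f x : Ec n →L[ℝ] Ec m) : Ec n →ₗ[ℝ] Ec m) = ⊤ :=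
      LinearMap.range_eq_top.2 h
    rw [derivRank, h1]
    simp

theorem isClosed_setOf_derivRank_lt {f : Ec n → Ec m} (hf : ContDiff ℝ 1 f) :
    IsClosed {x | derivRank f x < m} := by
  have h1 := (isOpen_setOfPred_nat_le_rank (𝕜 := ℝ) (E := Ec n) (F := Ec m) m).preimage
    (hf.continuous_fderiv one_ne_zero)
  rw [← isOpen_compl_iff]
  refine Eq.mp (congrArg IsOpen (Set.ext fun x => ?_)) h1
  change (m : Cardinal) ≤
    Module.rank ℝ (LinearMap.range ((fderiv ℝ f x : Ec n →L[ℝ] Ec m) : Ec n →ₗ[ℝ] Ec m)) ↔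
    ¬ derivRank f x < m
  rw [← Module.finrank_eq_rank, Nat.cast_le, not_lt, derivRank]

/-- The equidimensional case: critical values of a Lipschitz map form a null set. -/
theorem LipschitzWith.volume_image_derivRank_lt {f : Ec n → Ec n} {C : NNReal}
    (hf : LipschitzWith C f) : volume (f '' {x | derivRank f x < n}) = 0 := by
  let N : Set (Ec n) := {x | ¬ DifferentiableAt ℝ f x}
  have hN : volume (f '' N) = 0 := by
    have hn : Module.finrank ℝ (Ec n) = n := by simp
    have : (Measure.hausdorffMeasure n : Measure (Ec n)).IsAddHaarMeasure := by
      have := isAddHaarMeasure_hausdorffMeasure (E := Ec n)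
      rwa [hn] at this
    have h0 : (volume : Measure (Ec n)) N = 0 := ae_iff.1 hf.ae_differentiableAt
    have h1 : Measure.hausdorffMeasure n N = 0 :=
      Measure.absolutelyContinuous_isAddHaarMeasure _ _ h0
    have h2 := hf.hausdorffMeasure_image_le (d := (n : ℝ)) (Nat.cast_nonneg _) N
    rw [h1, mul_zero] at h2
    exact Measure.absolutelyContinuous_isAddHaarMeasure _ _ (le_antisymm h2 zero_le)
  have hD : volume (f '' ({x | derivRank f x < n} ∩ Nᶜ)) = 0 := by
    refine addHaar_image_eq_zero_of_det_fderivWithin_eq_zero volume (f' := fderiv ℝ f)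
      (fun x hx => (not_not.1 hx.2).hasFDerivAt.hasFDerivWithinAt) fun x hx => ?_
    by_contra hdet
    refine derivRank_lt_iff.1 hx.1 ?_
    exact ((LinearEquiv.ofIsUnitDet (v := Module.finBasis ℝ (Ec n)) (v' := Module.finBasis ℝ (Ec n))
      (f := ((fderiv ℝ f x : Ec n →L[ℝ] Ec n) : Ec n →ₗ[ℝ] Ec n))
      (by rw [LinearMap.det_toMatrix]; exact isUnit_iff_ne_zero.2 hdet))).surjective
  refine measure_mono_null ?_ (measure_union_null hN hD)
  rw [← image_union]
  refine image_mono fun x hx => ?_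
  by_cases h : x ∈ N
  exacts [Or.inl h, Or.inr ⟨hx, h⟩]

end CriticalValues

/-- Bates: if `m ≤ n` and `f ∈ C^{n-m,1}(ℝⁿ;ℝᵐ)` (`(n-m)` times
differentiable with Lipschitz `(n-m)`-th derivative; for `n = m` this is `C^{0,1}`, i.e.
Lipschitz), then the set of critical values `f(C_f)`, `C_f = {x : rank Df(x) < m}`, has
Lebesgue measure zero in `ℝᵐ`. -/
theorem bates {n m : ℕ} (hm : 0 < m) (hmn : m ≤ n)
    (f : Ec n → Ec m) (hf : ContDiff ℝ (n - m) f)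
    (hLip : ∃ L : NNReal, LipschitzWith L (iteratedFDeriv ℝ (n - m) f)) :
    volume (f '' {x | derivRank f x < m}) = 0 := by
  obtain ⟨C, hC⟩ := hLip
  rcases hmn.eq_or_lt with rfl | hlt
  · refine LipschitzWith.volume_image_derivRank_lt (C := C) ?_
    rw [Nat.sub_self, iteratedFDeriv_zero_eq_comp] at hC
    exact fun x y => ((continuousMultilinearCurryFin0 ℝ (Ec m) (Ec m)).symm.edist_map _ _).ge.trans
      (hC x y)
  · obtain ⟨j, rfl⟩ : ∃ j, n = m + (j + 1) := ⟨n - m - 1, by omega⟩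
    have hcast : (((m + (j + 1) : ℕ) : WithTop ℕ∞) - m) = ((j + 1 : ℕ) : WithTop ℕ∞) := by
      have h : ∀ a b : ℕ, (a : WithTop ℕ∞) - b = ((a - b : ℕ) : WithTop ℕ∞) := fun a b => by
        norm_cast
      rw [h, Nat.add_sub_cancel_left]
    rw [hcast] at hf
    rw [Nat.add_sub_cancel_left] at hC
    have hm' : Module.finrank ℝ (Ec m) = m := by simp
    have : (Measure.hausdorffMeasure m : Measure (Ec m)).IsAddHaarMeasure := by
      have := isAddHaarMeasure_hausdorffMeasure (E := Ec m)
      rwa [hm'] at this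
    refine Measure.absolutelyContinuous_isAddHaarMeasure _ (Measure.hausdorffMeasure m) ?_
    refine hausdorffMeasure_image_eq_zero_of_not_surjective j m (by simp) hm' ?_ (fun x _ => ?_)
      fun x hx => derivRank_lt_iff.1 hx
    · exact isSigmaCompact_univ.of_isClosed_subset
        (isClosed_setOf_derivRank_lt (hf.of_le (by norm_cast; omega))) (subset_univ _)
    · refine .of_contDiffOn_holderOnWith (C := C) hf.contDiffOn univ_mem ?_
      exact (holderWith_one.2 hC).holderOnWith univ

end
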